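/- Let G = (V,E) be a finite simple graph with m ≥ 1 edges and let 𝒞 be a partition of V containing a cluster C that is the disjoint union of two nonempty sets C₁ and C₂ with no edge of G between C₁ and C₂, such that both ∑_{v∈C₁} deg(v) > 0 and ∑_{v∈C₂} deg(v) > 0. Then the partition 𝒞' obtained from 𝒞 by replacing C with the two clusters C₁ and C₂ satisfies Q(𝒞') > Q(𝒞). -/

import Mathlib

open Finset

/-- The number of edges of a simple graph. -/
noncomputable def edgeCount {V : Type*} (G : SimpleGraph V) : ℕ :=
  Nat.card G.edgeSet

/-- The degree of a vertex. -/
noncomputable def deg {V : Type*} (G : SimpleGraph V) (v : V) : ℕ :=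
  Nat.card (G.neighborSet v)

/-- `E(C)`: the number of edges with both endpoints in `C`. -/
noncomputable def edgesIn {V : Type*} (G : SimpleGraph V) (C : Finset V) : ℕ :=
  Nat.card {e : G.edgeSet // ∀ v ∈ (e : Sym2 V), v ∈ C}

/-- `E(C,C')`: the number of edges with one endpoint in `C` and the other in `C'`. -/
noncomputable def edgesBetween {V : Type*} (G : SimpleGraph V) (C C' : Finset V) : ℕ :=
  Nat.card {e : G.edgeSet // ∃ u ∈ C, ∃ w ∈ C', (e : Sym2 V) = s(u, w)}

/-- The number of inter-cluster edges of a partition: edges whose endpoints do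
not both lie in a single cluster. -/
noncomputable def interEdges {V : Type*} [Fintype V] [DecidableEq V] (G : SimpleGraph V)
    (P : Finpartition (univ : Finset V)) : ℕ :=
  Nat.card {e : G.edgeSet // ∀ C ∈ P.parts, ¬ ∀ v ∈ (e : Sym2 V), v ∈ C}

/-- The modularity of a partition of the vertex set of a simple graph. -/
noncomputable def modularity {V : Type*} [Fintype V] [DecidableEq V] (G : SimpleGraph V)
    (P : Finpartition (univ : Finset V)) : ℝ :=
  ∑ C ∈ P.parts,
    ((edgesIn G C : ℝ) / (edgeCount G : ℝ)
      - ((∑ v ∈ C, (deg G v : ℝ)) / (2 * (edgeCount G : ℝ))) ^ 2)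

/-- If no edge joins the disjoint sets `A` and `B`, the edges inside `A ∪ B` are those inside `A`
together with those inside `B`. -/
theorem edgesIn_union_of_not_adj {V : Type*} [Finite V] [DecidableEq V] (G : SimpleGraph V)
    {A B : Finset V} (hdisj : Disjoint A B) (h : ∀ u ∈ A, ∀ w ∈ B, ¬ G.Adj u w) :
    edgesIn G (A ∪ B) = edgesIn G A + edgesIn G B := by
  have key : {e : G.edgeSet | ∀ v ∈ (e : Sym2 V), v ∈ A ∪ B} =
      {e : G.edgeSet | ∀ v ∈ (e : Sym2 V), v ∈ A} ∪
        {e : G.edgeSet | ∀ v ∈ (e : Sym2 V), v ∈ B} := by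
    ext ⟨e, he⟩
    induction e using Sym2.ind with
    | _ x y =>
      have hxy : G.Adj x y := he
      have h₁ := h x
      have h₂ := h y
      have hyx := hxy.symm
      simp only [Set.mem_ofPred_eq, Set.mem_union, Sym2.mem_iff, forall_eq_or_imp, forall_eq,
        Finset.mem_union]
      grind
  have hd : Disjoint {e : G.edgeSet | ∀ v ∈ (e : Sym2 V), v ∈ A}
      {e : G.edgeSet | ∀ v ∈ (e : Sym2 V), v ∈ B} := by
    rw [Set.disjoint_left]
    rintro ⟨e, he⟩ hA hB
    induction e using Sym2.ind with
    | _ x y =>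
      exact Finset.disjoint_left.mp hdisj (hA x (Sym2.mem_mk_left x y))
        (hB x (Sym2.mem_mk_left x y))
  have hcard := Set.ncard_union_eq hd (Set.toFinite _) (Set.toFinite _)
  rw [← key] at hcard
  exact hcard

/-- A nonempty subset of a part is not itself one of the other parts. -/
theorem Finpartition.notMem_erase_parts_of_subset {V : Type*} [DecidableEq V] {s : Finset V}
    (P : Finpartition s) {A C : Finset V} (hC : C ∈ P.parts) (hA : A.Nonempty) (hAC : A ⊆ C) :
    A ∉ P.parts.erase C := by
  intro h
  obtain ⟨hne, hmem⟩ := Finset.mem_erase.mp h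
  obtain ⟨x, hx⟩ := hA
  exact Finset.disjoint_left.mp (P.disjoint hmem hC hne) hx (hAC hx)

/-- Splitting a cluster that is a disjoint union of two parts with no edges in
between (and both of positive total degree) strictly increases modularity. -/
theorem modularity_lt_of_split_disconnected {V : Type*} [Fintype V] [DecidableEq V]
    (G : SimpleGraph V) (hm : 1 ≤ edgeCount G)
    (P P' : Finpartition (univ : Finset V)) (C C₁ C₂ : Finset V)
    (hC : C ∈ P.parts) (h1 : C₁.Nonempty) (h2 : C₂.Nonempty)
    (hdisj : Disjoint C₁ C₂) (hunion : C = C₁ ∪ C₂)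
    (hnoedge : ∀ u ∈ C₁, ∀ w ∈ C₂, ¬ G.Adj u w)
    (hd1 : 0 < ∑ v ∈ C₁, deg G v) (hd2 : 0 < ∑ v ∈ C₂, deg G v)
    (hP' : P'.parts = insert C₁ (insert C₂ (P.parts.erase C))) :
    modularity G P < modularity G P' := by
  have hC₁ := P.notMem_erase_parts_of_subset hC h1 (hunion ▸ subset_union_left)
  have hC₂ := P.notMem_erase_parts_of_subset hC h2 (hunion ▸ subset_union_right)
  have hne : C₁ ≠ C₂ := by
    rintro rfl
    exact h1.ne_empty (disjoint_self.mp hdisj)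
  have hC₁' : C₁ ∉ insert C₂ (P.parts.erase C) := by
    rw [mem_insert]
    exact not_or.mpr ⟨hne, hC₁⟩
  unfold modularity
  rw [hP', sum_insert hC₁', sum_insert hC₂, ← add_sum_erase _ _ hC, ← add_assoc]
  refine add_lt_add_left ?_ _
  rw [hunion, edgesIn_union_of_not_adj G hdisj hnoedge, sum_union hdisj]
  have hm' : (0 : ℝ) < 2 * edgeCount G := by
    have : (1 : ℝ) ≤ edgeCount G := by exact_mod_cast hm
    linarith
  have ha : 0 < (∑ v ∈ C₁, (deg G v : ℝ)) / (2 * edgeCount G) :=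
    div_pos (by exact_mod_cast hd1) hm'
  have hb : 0 < (∑ v ∈ C₂, (deg G v : ℝ)) / (2 * edgeCount G) :=
    div_pos (by exact_mod_cast hd2) hm'
  push_cast
  rw [add_div, add_div]
  nlinarith [mul_pos ha hb]
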